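/- arXiv:1204.6419 — 2 statements merged into one kernel-verified Lean document; each statement's English description precedes it below -/
import Mathlib

section
/- Let σ be a Y-periodic stress field on ℝ² that is divergence-free in the sense of distributions. If σ is continuous on an open neighborhood of the vertical line {β} × ℝ for some β ∈ ℝ, then (1/(l₁l₂)) ∫_Y σ₁₂ dx = (1/l₂) ∫_0^{l₂} σ₁₂(β, y) dy; if σ is continuous on an open neighborhood of the horizontal line ℝ × {α} for some α ∈ ℝ, then (1/(l₁l₂)) ∫_Y σ₁₂ dx = (1/l₁) ∫_0^{l₁} σ₁₂(x, α) dx. -/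
open MeasureTheory Set

/-- First partial derivative of a scalar field on `ℝ × ℝ`. -/
noncomputable def pd1 (f : ℝ × ℝ → ℝ) (p : ℝ × ℝ) : ℝ := fderiv ℝ f p (1, 0)

/-- Second partial derivative of a scalar field on `ℝ × ℝ`. -/
noncomputable def pd2 (f : ℝ × ℝ → ℝ) (p : ℝ × ℝ) : ℝ := fderiv ℝ f p (0, 1)

open Topology in
lemma aux_dbr (F : ℝ → ℝ) (hF : LocallyIntegrable F volume)
    (h : ∀ ψ : ℝ → ℝ, ContDiff ℝ (⊤ : ℕ∞) ψ → HasCompactSupport ψ →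
      ∫ x, deriv ψ x * F x = 0) : ∃ c : ℝ, ∀ᵐ x, F x = c := by
  let b : ContDiffBump (0:ℝ) := ⟨1, 2, one_pos, one_lt_two⟩
  set η : ℝ → ℝ := b.normed volume with hη
  have hη1 : ContDiff ℝ (⊤ : ℕ∞) η := b.contDiff_normed
  have hη2 : HasCompactSupport η := b.hasCompactSupport_normed
  have hη3 : ∫ x, η x = 1 := b.integral_normed
  have hint : ∀ g : ℝ → ℝ, Continuous g → HasCompactSupport g →
      Integrable (fun x => g x * F x) := fun g h1 h2 => by
    simpa using hF.integrable_smul_left_of_hasCompactSupport h1 h2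
  refine ⟨∫ x, η x * F x, ?_⟩
  set c := ∫ x, η x * F x with hc
  have key := ae_eq_zero_of_integral_contDiff_smul_eq_zero (μ := volume)
    (f := fun x => F x - c) (hF.sub (continuous_const.locallyIntegrable)) ?_
  · filter_upwards [key] with x hx
    linarith
  intro g hg1 hg2
  set m := ∫ x, g x with hm
  set g0 : ℝ → ℝ := fun x => g x - m * η x with hg0
  have hg01 : ContDiff ℝ (⊤ : ℕ∞) g0 := hg1.sub (contDiff_const.mul hη1)
  have hg02 : HasCompactSupport g0 := by
    apply HasCompactSupport.sub hg2
    exact hη2.mul_left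
  have hgi : Integrable g := hg1.continuous.integrable_of_hasCompactSupport hg2
  have hηi : Integrable η := hη1.continuous.integrable_of_hasCompactSupport hη2
  have hg03 : ∫ x, g0 x = 0 := by
    rw [hg0, integral_sub hgi (hηi.const_mul _), integral_const_mul, hη3]
    simp [hm]
  obtain ⟨R, hR⟩ : ∃ R : ℝ, tsupport g0 ⊆ Icc (-R) R := by
    obtain ⟨R, hR⟩ := hg02.isCompact.isBounded.subset_closedBall 0
    exact ⟨R, by simpa [Real.closedBall_eq_Icc] using hR⟩
  have hz : ∀ x, x ∉ Icc (-R) R → g0 x = 0 := fun x hx =>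
    image_eq_zero_of_notMem_tsupport (fun h => hx (hR h))
  set ψ : ℝ → ℝ := fun x => ∫ t in (-R)..x, g0 t with hψ
  have hd : ∀ x, HasDerivAt ψ (g0 x) x := fun x =>
    (hg01.continuous.integral_hasStrictDerivAt _ _).hasDerivAt
  have hd' : deriv ψ = g0 := funext fun x => (hd x).deriv
  have hψ1 : ContDiff ℝ (⊤ : ℕ∞) ψ := by
    rw [contDiff_infty_iff_deriv]
    exact ⟨fun x => (hd x).differentiableAt, by rw [hd']; exact hg01⟩
  have hψ2 : HasCompactSupport ψ := by
    apply HasCompactSupport.intro (isCompact_Icc (a := -R) (b := R))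
    intro x hx
    rw [mem_Icc, not_and_or, not_le, not_le] at hx
    have hx' : x < -R ∨ (-R ≤ x ∧ R < x) := by
      rcases hx with hx | hx
      · exact Or.inl hx
      · rcases lt_or_ge x (-R) with h | h
        · exact Or.inl h
        · exact Or.inr ⟨h, hx⟩
    rcases hx' with hx | ⟨hx, hx2⟩
    · have : ∫ t in x..(-R), g0 t = 0 := by
        rw [intervalIntegral.integral_of_le hx.le, integral_Ioc_eq_integral_Ioo]
        apply setIntegral_eq_zero_of_forall_eq_zero
        intro y hy
        exact hz y (fun h => absurd h.1 (not_le.2 hy.2))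
      rw [hψ]; simp only; rw [intervalIntegral.integral_symm, this, neg_zero]
    · rw [hψ]; simp only
      rw [intervalIntegral.integral_of_le hx, ← integral_Icc_eq_integral_Ioc,
        setIntegral_eq_integral_of_forall_compl_eq_zero, hg03]
      intro y hy
      apply hz
      intro hy2
      exact hy ⟨hy2.1, hy2.2.trans hx2.le⟩
  have := h ψ hψ1 hψ2
  rw [hd'] at this
  have e1 : ∫ x, g0 x * F x = (∫ x, g x * F x) - m * c := by
    rw [hc, ← integral_const_mul, ← integral_sub (hint g hg1.continuous hg2)
      ((hint η hη1.continuous hη2).const_mul m)]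
    congr 1; ext x; simp only [hg0]; ring
  have e2 : ∫ x, g x • (F x - c) = (∫ x, g x * F x) - m * c := by
    rw [hm, ← integral_mul_const, ← integral_sub (hint g hg1.continuous hg2)
      (hgi.mul_const c)]
    congr 1; ext x; simp only [smul_eq_mul]; ring
  rw [e2, ← e1, this]

lemma aux_int (f : ℝ × ℝ → ℝ) (hf : LocallyIntegrable f volume) (a k : ℝ → ℝ)
    (ha : Continuous a) (ha' : HasCompactSupport a) (hk : Measurable k) (C A B : ℝ)
    (hC : ∀ y, |k y| ≤ C) (hz : ∀ y, y ∉ Icc A B → k y = 0) :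
    Integrable (fun p : ℝ × ℝ => f p * (a p.1 * k p.2)) := by
  obtain ⟨D, hD⟩ := ha'.exists_bound_of_continuous ha
  have hK : IsCompact (tsupport a ×ˢ Icc A B) := IsCompact.prod ha' isCompact_Icc
  have h1 : IntegrableOn (fun p : ℝ × ℝ => f p * (a p.1 * k p.2)) (tsupport a ×ˢ Icc A B) := by
    refine Integrable.mul_bdd (c := D * C) (hf.integrableOn_isCompact hK) ?_ ?_
    · have : Measurable (fun p : ℝ × ℝ => a p.1 * k p.2) :=
        (ha.measurable.comp measurable_fst).mul (hk.comp measurable_snd)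
      exact this.aestronglyMeasurable
    · refine Filter.Eventually.of_forall fun p => ?_
      rw [norm_mul]
      exact mul_le_mul (hD _) (hC _) (abs_nonneg _) ((norm_nonneg _).trans (hD p.1))
  rw [integrableOn_iff_integrable_of_support_subset] at h1
  · exact h1
  · intro p hp
    by_contra hn
    apply hp
    simp only [mem_prod, not_and_or] at hn
    rcases hn with hn | hn
    · simp [image_eq_zero_of_notMem_tsupport hn]
    · simp [hz _ hn]

lemma aux_trans (f : ℝ × ℝ → ℝ) (l : ℝ) (hp : ∀ᵐ p : ℝ × ℝ, f (p.1, p.2 + l) = f p)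
    (a k : ℝ → ℝ) :
    ∫ p : ℝ × ℝ, f p * (a p.1 * k (p.2 - l)) = ∫ p : ℝ × ℝ, f p * (a p.1 * k p.2) := by
  rw [← integral_add_right_eq_self (μ := (volume : Measure (ℝ × ℝ))) _ ((0, l) : ℝ × ℝ)]
  apply integral_congr_ae
  filter_upwards [hp] with p hp
  have : p + ((0, l) : ℝ × ℝ) = (p.1, p.2 + l) := by ext <;> simp
  simp [this, hp]

lemma aux_pd (ψ χ : ℝ → ℝ) (h1 : Differentiable ℝ ψ) (h2 : Differentiable ℝ χ) (p : ℝ × ℝ) :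
    pd1 (fun q => ψ q.1 * χ q.2) p = deriv ψ p.1 * χ p.2 ∧
    pd2 (fun q => ψ q.1 * χ q.2) p = ψ p.1 * deriv χ p.2 := by
  have e1 : HasFDerivAt (fun q : ℝ × ℝ => ψ q.1) _ p :=
    (h1 p.1).hasDerivAt.hasFDerivAt.comp p hasFDerivAt_fst
  have e2 : HasFDerivAt (fun q : ℝ × ℝ => χ q.2) _ p :=
    (h2 p.2).hasDerivAt.hasFDerivAt.comp p hasFDerivAt_snd
  have e := (e1.mul e2).fderiv
  unfold pd1 pd2
  constructor
  · erw [e]; simp [mul_comm]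
  · erw [e]; simp

/-- The integral of `f` over vertical segments is a.e. constant. -/
lemma aux_const (f g : ℝ × ℝ → ℝ) (hf : LocallyIntegrable f volume)
    (hg : LocallyIntegrable g volume) (l : ℝ) (hl : 0 < l)
    (hfp : ∀ᵐ p : ℝ × ℝ, f (p.1, p.2 + l) = f p)
    (hgp : ∀ᵐ p : ℝ × ℝ, g (p.1, p.2 + l) = g p)
    (hdiv : ∀ φ : ℝ × ℝ → ℝ, ContDiff ℝ (⊤ : ℕ∞) φ → HasCompactSupport φ →
      ∫ p : ℝ × ℝ, (f p * pd1 φ p + g p * pd2 φ p) = 0) :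
    ∃ c : ℝ, ∀ᵐ x, ∫ y in Ioc 0 l, f (x, y) = c := by
  apply aux_dbr
  · rw [locallyIntegrable_iff]
    intro K hK
    have h1 : IntegrableOn f (K ×ˢ Ioc 0 l) :=
      (hf.integrableOn_isCompact (hK.prod isCompact_Icc)).mono_set
        (prod_mono subset_rfl Ioc_subset_Icc_self)
    rw [IntegrableOn, Measure.volume_eq_prod, ← Measure.prod_restrict] at h1
    exact h1.integral_prod_left
  intro ψ hψ hψ'
  set S : ℝ → ℝ := fun y => Real.smoothTransition (y / l) with hS
  have hS1 : ContDiff ℝ (⊤ : ℕ∞) S :=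
    Real.smoothTransition.contDiff.comp (contDiff_id.div_const l)
  have hS0 : ∀ y, y ≤ 0 → S y = 0 := fun y hy =>
    Real.smoothTransition.zero_of_nonpos (div_nonpos_of_nonpos_of_nonneg hy hl.le)
  have hSl : ∀ y, l ≤ y → S y = 1 := fun y hy =>
    Real.smoothTransition.one_of_one_le ((one_le_div hl).2 hy)
  have hSb : ∀ y, 0 ≤ S y ∧ S y ≤ 1 := fun y =>
    ⟨Real.smoothTransition.nonneg _, Real.smoothTransition.le_one _⟩
  set χ : ℝ → ℝ := fun y => S y - S (y - l) with hχ
  have hχ1 : ContDiff ℝ (⊤ : ℕ∞) χ := hS1.sub (hS1.comp (contDiff_id.sub contDiff_const))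
  have hχ0 : ∀ y, y ∉ Icc 0 (2 * l) → χ y = 0 := by
    intro y hy
    rw [mem_Icc, not_and_or, not_le, not_le] at hy
    rcases hy with hy | hy
    · simp [hχ, hS0 y hy.le, hS0 (y - l) (by linarith)]
    · simp [hχ, hSl y (by linarith), hSl (y - l) (by linarith)]
  have hSd : Differentiable ℝ S := hS1.differentiable (by simp)
  have hχd : Differentiable ℝ χ := hχ1.differentiable (by simp)
  have hψd : Differentiable ℝ ψ := hψ.differentiable (by simp)
  have hdχ : ∀ y, deriv χ y = deriv S y - deriv S (y - l) := by
    intro y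
    have e1 := (hSd y).hasDerivAt
    have e2 := (hSd (y - l)).hasDerivAt.comp_sub_const y l
    exact (e1.sub e2).deriv
  have hS'0 : ∀ y, y ∉ Icc 0 l → deriv S y = 0 := by
    intro y hy
    rw [mem_Icc, not_and_or, not_le, not_le] at hy
    rcases hy with hy | hy
    · have : S =ᶠ[nhds y] fun _ => 0 := by
        filter_upwards [Iio_mem_nhds hy] with z hz using hS0 z (le_of_lt hz)
      rw [this.deriv_eq]; simp
    · have : S =ᶠ[nhds y] fun _ => 1 := by
        filter_upwards [Ioi_mem_nhds hy] with z hz using hSl z (le_of_lt hz)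
      rw [this.deriv_eq]; simp
  have hS'c : Continuous (deriv S) := hS1.continuous_deriv (by simp)
  have hψ'c : Continuous (deriv ψ) := hψ.continuous_deriv (by simp)
  obtain ⟨C, hC⟩ := (HasCompactSupport.intro isCompact_Icc hS'0).exists_bound_of_continuous hS'c
  -- the test function
  have hφ1 : ContDiff ℝ (⊤ : ℕ∞) (fun q : ℝ × ℝ => ψ q.1 * χ q.2) :=
    (hψ.comp contDiff_fst).mul (hχ1.comp contDiff_snd)
  have hφ2 : HasCompactSupport (fun q : ℝ × ℝ => ψ q.1 * χ q.2) := by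
    apply HasCompactSupport.intro (IsCompact.prod hψ' (isCompact_Icc (a := 0) (b := 2 * l)))
    intro p hn
    simp only [mem_prod, not_and_or] at hn
    rcases hn with hn | hn
    · simp [image_eq_zero_of_notMem_tsupport hn]
    · simp [hχ0 _ hn]
  have h0 := hdiv _ hφ1 hφ2
  simp only [(aux_pd ψ χ hψd hχd _).1, (aux_pd ψ χ hψd hχd _).2] at h0
  -- the k function
  set k : ℝ → ℝ := (Ioc 0 l).indicator (fun y => S y - 1) with hk
  set o : ℝ → ℝ := (Ioc 0 l).indicator (fun _ => 1) with ho
  have hkm : Measurable k := (hS1.continuous.measurable.sub_const 1).indicator measurableSet_Ioc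
  have hom : Measurable o := measurable_const.indicator measurableSet_Ioc
  have hkb : ∀ y, |k y| ≤ 1 := by
    intro y
    rw [abs_le]
    by_cases hy : y ∈ Ioc 0 l
    · simp only [hk, indicator_of_mem hy]
      constructor <;> linarith [(hSb y).1, (hSb y).2]
    · simp [hk, indicator_of_notMem hy]
  have hob : ∀ y, |o y| ≤ 1 := by
    intro y
    by_cases hy : y ∈ Ioc 0 l
    · simp [ho, indicator_of_mem hy]
    · simp [ho, indicator_of_notMem hy]
  have hk0 : ∀ y, y ∉ Icc 0 l → k y = 0 := fun y hy =>
    indicator_of_notMem (fun h => hy (Ioc_subset_Icc_self h)) _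
  have ho0 : ∀ y, y ∉ Icc 0 l → o y = 0 := fun y hy =>
    indicator_of_notMem (fun h => hy (Ioc_subset_Icc_self h)) _
  have hχk : ∀ y, χ y = o y + k y - k (y - l) := by
    intro y
    simp only [hχ, ho, hk, indicator, mem_Ioc]
    rcases le_or_gt y 0 with h1 | h1
    · rw [if_neg (by rintro ⟨h, -⟩; linarith), if_neg (by rintro ⟨h, -⟩; linarith),
        if_neg (by rintro ⟨h, -⟩; linarith), hS0 y h1, hS0 (y - l) (by linarith)]; ring
    rcases le_or_gt y l with h2 | h2
    · rw [if_pos ⟨h1, h2⟩, if_pos ⟨h1, h2⟩,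
        if_neg (by rintro ⟨h, -⟩; linarith), hS0 (y - l) (by linarith)]; ring
    rw [if_neg (by rintro ⟨-, h⟩; linarith), if_neg (by rintro ⟨-, h⟩; linarith),
      hSl y h2.le]
    rcases le_or_gt (y - l) l with h3 | h3
    · rw [if_pos ⟨by linarith, h3⟩]; ring
    · rw [if_neg (by rintro ⟨-, h⟩; linarith), hSl (y - l) h3.le]; ring
  -- integrability
  have shift : ∀ w : ℝ → ℝ, (∀ y, y ∉ Icc 0 l → w y = 0) →
      ∀ y, y ∉ Icc l (2 * l) → w (y - l) = 0 := by
    intro w hw y hy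
    apply hw
    intro h
    exact hy ⟨by linarith [h.1], by linarith [h.2]⟩
  have msh : Measurable fun y : ℝ => y - l := measurable_id.sub_const l
  have Io := aux_int f hf (deriv ψ) o hψ'c hψ'.deriv hom 1 0 l hob ho0
  have Ik := aux_int f hf (deriv ψ) k hψ'c hψ'.deriv hkm 1 0 l hkb hk0
  have Ik' := aux_int f hf (deriv ψ) (fun y => k (y - l)) hψ'c hψ'.deriv (hkm.comp msh) 1 l (2 * l)
    (fun y => hkb _) (shift k hk0)
  have Is := aux_int g hg ψ (deriv S) hψ.continuous hψ' hS'c.measurable C 0 l hC hS'0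
  have Is' := aux_int g hg ψ (fun y => deriv S (y - l)) hψ.continuous hψ'
    (hS'c.measurable.comp msh) C l (2 * l) (fun y => hC _) (shift _ hS'0)
  have e : ∫ p : ℝ × ℝ, f p * (deriv ψ p.1 * o p.2) = 0 := by
    rw [← h0]
    have : ∀ p : ℝ × ℝ, f p * (deriv ψ p.1 * χ p.2) + g p * (ψ p.1 * deriv χ p.2)
      = (f p * (deriv ψ p.1 * o p.2) + (f p * (deriv ψ p.1 * k p.2)
          - f p * (deriv ψ p.1 * k (p.2 - l))))
        + (g p * (ψ p.1 * deriv S p.2) - g p * (ψ p.1 * deriv S (p.2 - l))) := by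
      intro p; rw [hχk, hdχ]; ring
    simp only [this]
    have J1 : Integrable (fun p : ℝ × ℝ => f p * (deriv ψ p.1 * k p.2)
          - f p * (deriv ψ p.1 * k (p.2 - l))) := Ik.sub Ik'
    have J2 : Integrable (fun p : ℝ × ℝ => g p * (ψ p.1 * deriv S p.2)
          - g p * (ψ p.1 * deriv S (p.2 - l))) := Is.sub Is'
    have J3 : Integrable (fun p : ℝ × ℝ => f p * (deriv ψ p.1 * o p.2)
          + (f p * (deriv ψ p.1 * k p.2) - f p * (deriv ψ p.1 * k (p.2 - l)))) := Io.add J1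
    rw [integral_add J3 J2, integral_add Io J1, integral_sub Ik Ik', integral_sub Is Is', aux_trans f l hfp, aux_trans g l hgp]
    ring
  rw [Measure.volume_eq_prod, integral_prod _ Io] at e
  refine Eq.trans ?_ e
  congr 1; ext x
  rw [← integral_indicator measurableSet_Ioc, ← integral_const_mul]
  congr 1; ext y
  by_cases hy : y ∈ Ioc 0 l
  · simp [ho, hy]; ring
  · simp [ho, hy]

open Topology in
lemma aux_core (f g : ℝ × ℝ → ℝ) (hf : LocallyIntegrable f volume)
    (hg : LocallyIntegrable g volume) (m l : ℝ) (hm : 0 < m) (hl : 0 < l)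
    (hfp : ∀ᵐ p : ℝ × ℝ, f (p.1, p.2 + l) = f p)
    (hgp : ∀ᵐ p : ℝ × ℝ, g (p.1, p.2 + l) = g p)
    (hdiv : ∀ φ : ℝ × ℝ → ℝ, ContDiff ℝ (⊤ : ℕ∞) φ → HasCompactSupport φ →
      ∫ p : ℝ × ℝ, (f p * pd1 φ p + g p * pd2 φ p) = 0)
    (β : ℝ) (U : Set (ℝ × ℝ)) (hU : IsOpen U) (hβ : ∀ y, (β, y) ∈ U) (hc : ContinuousOn f U) :
    (1 / (m * l)) * ∫ p in Ioo (0:ℝ) m ×ˢ Ioo (0:ℝ) l, f p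
      = (1 / l) * ∫ y in (0:ℝ)..l, f (β, y) := by
  obtain ⟨c, hcc⟩ := aux_const f g hf hg l hl hfp hgp hdiv
  have hI : IntegrableOn f (Ioo (0:ℝ) m ×ˢ Ioo (0:ℝ) l) :=
    (hf.integrableOn_isCompact ((isCompact_Icc (a := 0) (b := m)).prod
      (isCompact_Icc (a := 0) (b := l)))).mono_set
        (prod_mono Ioo_subset_Icc_self Ioo_subset_Icc_self)
  have h1 : ∫ p in Ioo (0:ℝ) m ×ˢ Ioo (0:ℝ) l, f p = m * c := by
    rw [Measure.volume_eq_prod, setIntegral_prod _ hI]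
    have : ∀ᵐ x ∂(volume.restrict (Ioo (0:ℝ) m)), ∫ y in Ioo 0 l, f (x, y) = c := by
      apply ae_restrict_of_ae
      filter_upwards [hcc] with x hx
      rw [← hx, integral_Ioc_eq_integral_Ioo]
    rw [integral_congr_ae this]
    simp [hm.le]
  -- continuity at β
  have hK : IsCompact (({β} : Set ℝ) ×ˢ Icc 0 l) := isCompact_singleton.prod isCompact_Icc
  obtain ⟨u, v, hu, hv, hβu, hlv, huv⟩ := generalized_tube_lemma (isCompact_singleton (x := β))
    (isCompact_Icc (a := 0) (b := l)) hU (by rintro ⟨x, y⟩ ⟨hx, -⟩; cases hx; exact hβ y)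
  obtain ⟨δ, hδ, hδu⟩ := Metric.nhds_basis_closedBall.mem_iff.1
    (hu.mem_nhds (hβu (mem_singleton β)))
  have hsub : Metric.closedBall β δ ×ˢ Icc 0 l ⊆ U := (prod_mono hδu hlv).trans huv
  obtain ⟨D, hD⟩ := ((isCompact_closedBall β δ).prod
    (isCompact_Icc (a := 0) (b := l))).exists_bound_of_continuousOn (hc.mono hsub)
  have hι : uIoc 0 l ⊆ Icc 0 l := by
    rw [uIoc_of_le hl.le]; exact Ioc_subset_Icc_self
  have hcont : ContinuousAt (fun x => ∫ y in (0:ℝ)..l, f (x, y)) β := by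
    apply intervalIntegral.continuousAt_of_dominated_interval (bound := fun _ => D)
    · filter_upwards [Metric.closedBall_mem_nhds β hδ] with x hx
      have : ContinuousOn (fun y => f (x, y)) (uIoc 0 l) :=
        hc.comp (by fun_prop) (fun y hy => hsub ⟨hx, hι hy⟩)
      exact this.aestronglyMeasurable measurableSet_uIoc
    · filter_upwards [Metric.closedBall_mem_nhds β hδ] with x hx
      exact Filter.Eventually.of_forall fun y hy => hD (x, y) ⟨hx, hι hy⟩
    · simp
    · refine Filter.Eventually.of_forall fun y hy => ?_
      exact (hc.continuousAt (hU.mem_nhds (hβ y))).comp (f := fun x : ℝ => (x, y)) (by fun_prop)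
  have h2 : ∫ y in (0:ℝ)..l, f (β, y) = c := by
    have hd : Dense {x : ℝ | ∫ y in (0:ℝ)..l, f (x, y) = c} := by
      apply Measure.dense_of_ae (μ := volume)
      filter_upwards [hcc] with x hx
      rw [intervalIntegral.integral_of_le hl.le, hx]
    have hne := mem_closure_iff_nhdsWithin_neBot.1 (hd β)
    have t1 : Filter.Tendsto (fun x => ∫ y in (0:ℝ)..l, f (x, y))
      (𝓝[{x : ℝ | ∫ y in (0:ℝ)..l, f (x, y) = c}] β) (𝓝 (∫ y in (0:ℝ)..l, f (β, y))) :=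
      hcont.tendsto.mono_left nhdsWithin_le_nhds
    refine tendsto_nhds_unique t1 (Filter.Tendsto.congr' ?_ tendsto_const_nhds)
    filter_upwards [self_mem_nhdsWithin] with x hx
    exact hx.symm
  rw [h1, h2]
  field_simp

lemma aux_swap_pd (φ : ℝ × ℝ → ℝ) (hφ : Differentiable ℝ φ) (p : ℝ × ℝ) :
    pd1 (fun q : ℝ × ℝ => φ q.swap) p = pd2 φ p.swap ∧
    pd2 (fun q : ℝ × ℝ => φ q.swap) p = pd1 φ p.swap := by
  have e : HasFDerivAt (fun q : ℝ × ℝ => φ q.swap) _ p :=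
    (hφ p.swap).hasFDerivAt.comp p (ContinuousLinearEquiv.prodComm ℝ ℝ ℝ).hasFDerivAt
  unfold pd1 pd2
  constructor
  · erw [e.fderiv]; simp
  · erw [e.fderiv]; simp

/-- For a `Y`-periodic, distributionally divergence-free stress field, the cell average of
`σ₁₂` equals its line average over a vertical segment near which `σ` is continuous, and also
its line average over a horizontal segment near which `σ` is continuous. -/
theorem cell_average_eq_line_average_sigma12
    (l₁ l₂ : ℝ) (hl₁ : 0 < l₁) (hl₂ : 0 < l₂)
    (σ11 σ12 σ22 : ℝ × ℝ → ℝ)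
    (hloc11 : LocallyIntegrable σ11 volume)
    (hloc12 : LocallyIntegrable σ12 volume)
    (hloc22 : LocallyIntegrable σ22 volume)
    (hper : ∀ᵐ p : ℝ × ℝ ∂volume,
      σ11 (p.1 + l₁, p.2) = σ11 p ∧ σ11 (p.1, p.2 + l₂) = σ11 p ∧
      σ12 (p.1 + l₁, p.2) = σ12 p ∧ σ12 (p.1, p.2 + l₂) = σ12 p ∧
      σ22 (p.1 + l₁, p.2) = σ22 p ∧ σ22 (p.1, p.2 + l₂) = σ22 p)
    (hdiv : ∀ φ₁ φ₂ : ℝ × ℝ → ℝ, ContDiff ℝ (⊤ : ℕ∞) φ₁ → ContDiff ℝ (⊤ : ℕ∞) φ₂ →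
      HasCompactSupport φ₁ → HasCompactSupport φ₂ →
      ∫ p : ℝ × ℝ, (σ11 p * pd1 φ₁ p + σ12 p * pd2 φ₁ p
        + σ12 p * pd1 φ₂ p + σ22 p * pd2 φ₂ p) = 0) :
    (∀ β : ℝ,
      (∃ U : Set (ℝ × ℝ), IsOpen U ∧ (∀ y : ℝ, (β, y) ∈ U) ∧
        ContinuousOn σ11 U ∧ ContinuousOn σ12 U ∧ ContinuousOn σ22 U) →
      (1 / (l₁ * l₂)) * ∫ p in Ioo (0:ℝ) l₁ ×ˢ Ioo (0:ℝ) l₂, σ12 p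
        = (1 / l₂) * ∫ y in (0:ℝ)..l₂, σ12 (β, y)) ∧
    (∀ α : ℝ,
      (∃ U : Set (ℝ × ℝ), IsOpen U ∧ (∀ x : ℝ, (x, α) ∈ U) ∧
        ContinuousOn σ11 U ∧ ContinuousOn σ12 U ∧ ContinuousOn σ22 U) →
      (1 / (l₁ * l₂)) * ∫ p in Ioo (0:ℝ) l₁ ×ˢ Ioo (0:ℝ) l₂, σ12 p
        = (1 / l₁) * ∫ x in (0:ℝ)..l₁, σ12 (x, α)) := by
  have z1 : ∀ p, pd1 (fun _ => 0) p = 0 := fun p => by simp [pd1]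
  have z2 : ∀ p, pd2 (fun _ => 0) p = 0 := fun p => by simp [pd2]
  have zs : HasCompactSupport (fun _ : ℝ × ℝ => (0:ℝ)) := HasCompactSupport.zero
  constructor
  · rintro β ⟨U, hU, hβ, -, hc, -⟩
    refine aux_core σ12 σ22 hloc12 hloc22 l₁ l₂ hl₁ hl₂ (hper.mono fun p h => h.2.2.2.1)
      (hper.mono fun p h => h.2.2.2.2.2) ?_ β U hU hβ hc
    intro φ h1 h2
    have := hdiv (fun _ => 0) φ contDiff_const h1 zs h2
    simpa [z1, z2] using this
  · rintro α ⟨U, hU, hα, -, hc, -⟩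
    have mp : MeasurePreserving (Prod.swap : ℝ × ℝ → ℝ × ℝ) volume volume :=
      Measure.measurePreserving_swap
    have me : MeasurableEmbedding (Prod.swap : ℝ × ℝ → ℝ × ℝ) :=
      MeasurableEquiv.prodComm.measurableEmbedding
    have hli : ∀ f : ℝ × ℝ → ℝ, LocallyIntegrable f volume →
        LocallyIntegrable (fun p : ℝ × ℝ => f p.swap) volume := by
      intro f hf
      refine (locallyIntegrable_map_homeomorph (Homeomorph.prodComm ℝ ℝ)).1 ?_
      rw [show Measure.map (Homeomorph.prodComm ℝ ℝ) volume = volume from mp.map_eq]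
      exact hf
    have hsw := mp.quasiMeasurePreserving.ae hper
    have key := aux_core (fun p => σ12 p.swap) (fun p => σ11 p.swap) (hli _ hloc12) (hli _ hloc11)
      l₂ l₁ hl₂ hl₁ (hsw.mono fun p h => h.2.2.1)
      (hsw.mono fun p h => h.1) ?_ α (Prod.swap ⁻¹' U) (hU.preimage continuous_swap) hα
      (hc.comp continuous_swap.continuousOn fun p hp => hp)
    · have e : ∫ p in Ioo (0:ℝ) l₂ ×ˢ Ioo (0:ℝ) l₁, σ12 p.swap
          = ∫ p in Ioo (0:ℝ) l₁ ×ˢ Ioo (0:ℝ) l₂, σ12 p := by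
        rw [← mp.setIntegral_preimage_emb me, preimage_swap_prod]
        simp only [Prod.swap_swap]
      rw [e, mul_comm l₂ l₁] at key
      exact key
    intro φ h1 h2
    have hd := h1.differentiable (by simp)
    have := hdiv (fun p => φ p.swap) (fun _ => 0) 
      (h1.comp (contDiff_snd.prodMk contDiff_fst)) contDiff_const
      (h2.comp_homeomorph (Homeomorph.prodComm ℝ ℝ)) zs
    simp only [z1, z2, (aux_swap_pd φ hd _).1, (aux_swap_pd φ hd _).2, mul_zero, add_zero] at this
    rw [← mp.integral_comp me, ← this]
    congr 1; ext p
    simp [add_comm]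
end

section
/- Let σ be a Y-periodic stress field on ℝ², divergence-free in the sense of distributions, continuous on open neighborhoods of the lines ℝ × {α} and {β} × ℝ for some α, β ∈ ℝ. Let γ₁' = [β, β+l₁] × {α} and γ₂' = {β} × [α, α+l₂], and suppose there are an open set V ⊇ γ₁' ∪ γ₂' and a C² map u : V → ℝ² whose strain ε(u) satisfies Hooke's law with moduli K, G > 0 relative to σ on V (so σ is C¹ on V), such that σ satisfies ∂₁σ₁₁ + ∂₂σ₁₂ = 0 and ∂₁σ₁₂ + ∂₂σ₂₂ = 0 pointwise on V. Assume there is ξ₁₂ ∈ ℝ with u₂(β+l₁, α) − u₂(β, α) = ξ₁₂ l₁ and u₁(β, α+l₂) − u₁(β, α) = ξ₁₂ l₂, and that the rotation is periodic at the endpoints: ω₂₁(u)(β+l₁, α) = ω₂₁(u)(β, α) and ω₂₁(u)(β, α+l₂) = ω₂₁(u)(β, α). Then ξ₁₂ = (1/(2G)) ⨍_Y σ₁₂ + (1/8)(1/K + 1/G) [ (1/l₁) ∫_β^{β+l₁} ∂(σ₁₁+σ₂₂)/∂x₂ (t, α) · t dt + (1/l₂) ∫_α^{α+l₂} ∂(σ₁₁+σ₂₂)/∂x₁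 (β, t) · t dt ], where ⨍_Y σ₁₂ = (1/(l₁l₂))∫_Y σ₁₂ dx. -/
open MeasureTheory Set

/-- Strain component `ε₁₁` of a displacement field `u`. -/
noncomputable def eps11 (u : ℝ × ℝ → ℝ × ℝ) (p : ℝ × ℝ) : ℝ := pd1 (fun q => (u q).1) p

/-- Strain component `ε₂₂` of a displacement field `u`. -/
noncomputable def eps22 (u : ℝ × ℝ → ℝ × ℝ) (p : ℝ × ℝ) : ℝ := pd2 (fun q => (u q).2) p

/-- Strain component `ε₁₂` of a displacement field `u`. -/
noncomputable def eps12 (u : ℝ × ℝ → ℝ × ℝ) (p : ℝ × ℝ) : ℝ :=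
  (1 / 2) * (pd2 (fun q => (u q).1) p + pd1 (fun q => (u q).2) p)

/-- Rotation component `ω₂₁` of a displacement field `u`. -/
noncomputable def omega21 (u : ℝ × ℝ → ℝ × ℝ) (p : ℝ × ℝ) : ℝ :=
  (1 / 2) * (pd1 (fun q => (u q).2) p - pd2 (fun q => (u q).1) p)

/-- Bounded measurable function vanishing outside a bounded interval. -/
def BC1 (a : ℝ → ℝ) : Prop :=
  Measurable a ∧ ∃ C M : ℝ, ∀ x, |a x| ≤ C ∧ (M < |x| → a x = 0)

/-- Step-like function. -/
def Stp (a : ℝ → ℝ) : Prop :=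
  Measurable a ∧ ∃ M : ℝ, ∀ x, |a x| ≤ 1 ∧ (x < -M → a x = 0) ∧ (M < x → a x = 1)

lemma Stp.sub {a b : ℝ → ℝ} (ha : Stp a) (hb : Stp b) : BC1 (fun x => a x - b x) := by
  obtain ⟨ma, M, hM⟩ := ha
  obtain ⟨mb, N, hN⟩ := hb
  refine ⟨ma.sub mb, 2, max M N, fun x => ⟨?_, fun hx => ?_⟩⟩
  · have := abs_sub (a x) (b x)
    linarith [(hM x).1, (hN x).1]
  · show a x - b x = 0
    obtain ⟨h1, h2⟩ := max_lt_iff.1 hx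
    rcases lt_abs.1 h1 with h | h <;> rcases lt_abs.1 h2 with h' | h'
    · rw [(hM x).2.2 h, (hN x).2.2 h', sub_self]
    · by_cases h3 : N < x
      · rw [(hM x).2.2 h, (hN x).2.2 h3, sub_self]
      · by_cases h4 : x < - M
        · rw [(hM x).2.1 h4, (hN x).2.1 (by linarith), sub_self]
        · rcases lt_abs.1 hx with h5 | h5
          · exact absurd ((le_max_right _ _).trans_lt h5) h3
          · exact absurd (by linarith [le_max_left M N]) h4
    · by_cases h3 : M < x
      · rw [(hM x).2.2 h3, (hN x).2.2 h', sub_self]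
      · by_cases h4 : x < - N
        · rw [(hM x).2.1 (by linarith), (hN x).2.1 h4, sub_self]
        · rcases lt_abs.1 hx with h5 | h5
          · exact absurd ((le_max_left _ _).trans_lt h5) h3
          · exact absurd (by linarith [le_max_right M N]) h4
    · rw [(hM x).2.1 (by linarith), (hN x).2.1 (by linarith), sub_self]

lemma Stp.shift {a : ℝ → ℝ} (ha : Stp a) (l : ℝ) : Stp (fun x => a (x - l)) := by
  obtain ⟨ma, M, hM⟩ := ha
  refine ⟨ma.comp (measurable_id.sub_const l), M + |l|, fun x => ⟨(hM _).1, fun h => ?_, fun h => ?_⟩⟩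
  · exact (hM _).2.1 (by linarith [neg_abs_le l])
  · exact (hM _).2.2 (by linarith [le_abs_self l])

lemma stp_ind (c : ℝ) : Stp (fun x => if c < x then 1 else 0) := by
  refine ⟨Measurable.ite measurableSet_Ioi measurable_const measurable_const, |c|, fun x => ⟨?_, ?_, ?_⟩⟩
  · simp only; split_ifs <;> simp
  · intro h
    beta_reduce
    rw [if_neg]
    linarith [neg_abs_le c]
  · intro h
    beta_reduce
    rw [if_pos]
    linarith [le_abs_self c]

lemma ind_diff (c l x : ℝ) (hl : 0 < l) :
    ((if c < x then 1 else 0) - (if c < x - l then 1 else 0) : ℝ)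
      = (Ioc c (c + l)).indicator (fun _ => 1) x := by
  by_cases h1 : c < x
  · by_cases h2 : c < x - l
    · rw [if_pos h1, if_pos h2, indicator_of_notMem]
      · simp
      · rintro ⟨_, h⟩; linarith
    · rw [if_pos h1, if_neg h2, indicator_of_mem]
      · simp
      · exact ⟨h1, by linarith⟩
  · rw [if_neg h1, if_neg (by linarith), indicator_of_notMem]
    · simp
    · rintro ⟨h, _⟩; exact h1 h

/-- The smooth step. -/
noncomputable def sst (x : ℝ) : ℝ := Real.smoothTransition x

lemma sst_smooth : ContDiff ℝ (⊤ : ℕ∞) sst := Real.smoothTransition.contDiff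

lemma stp_sst : Stp sst := by
  refine ⟨Real.smoothTransition.continuous.measurable, 1, fun x => ⟨?_, ?_, ?_⟩⟩
  · rw [abs_le]
    have h1 := Real.smoothTransition.nonneg x
    have h2 := Real.smoothTransition.le_one x
    exact ⟨by unfold sst; linarith, h2⟩
  · intro h
    exact Real.smoothTransition.zero_of_nonpos (by linarith)
  · intro h
    exact Real.smoothTransition.one_of_one_le h.le

lemma BC1.compact {a : ℝ → ℝ} (ha : BC1 a) : HasCompactSupport a := by
  obtain ⟨_, C, M, h⟩ := ha
  refine HasCompactSupport.intro (isCompact_Icc (a := -M) (b := M)) fun x hx => (h x).2 ?_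
  by_contra hh
  exact hx (abs_le.1 (not_lt.1 hh))

lemma bc1_of_cont {a : ℝ → ℝ} (ha : Continuous a) (hc : HasCompactSupport a) : BC1 a := by
  obtain ⟨C, hC⟩ := hc.exists_bound_of_continuous ha
  obtain ⟨M, hM⟩ := hc.isCompact.isBounded.exists_norm_le
  refine ⟨ha.measurable, C, M, fun x => ⟨hC x, fun h => ?_⟩⟩
  by_contra hx
  have := hM x (subset_tsupport a hx)
  rw [Real.norm_eq_abs] at this
  linarith

lemma int_mul {g : ℝ × ℝ → ℝ} (hg : LocallyIntegrable g volume) {a b : ℝ → ℝ}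
    (ha : BC1 a) (hb : BC1 b) : Integrable (fun p => g p * (a p.1 * b p.2)) volume := by
  obtain ⟨ma, C, M, hM⟩ := ha
  obtain ⟨mb, D, N, hN⟩ := hb
  have hK : IsCompact (Icc (-M) M ×ˢ Icc (-N) N : Set (ℝ × ℝ)) := isCompact_Icc.prod isCompact_Icc
  rw [← integrableOn_iff_integrable_of_support_subset (s := Icc (-M) M ×ˢ Icc (-N) N)]
  · refine Integrable.mul_bdd (c := C * D) (hg.integrableOn_isCompact hK) ?_ ?_
    · exact ((ma.comp measurable_fst).mul (mb.comp measurable_snd)).aestronglyMeasurable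
    · refine Filter.Eventually.of_forall fun p => ?_
      rw [norm_mul]
      exact mul_le_mul (hM _).1 (hN _).1 (abs_nonneg _) ((abs_nonneg _).trans (hM p.1).1)
  · intro p hp
    simp only [Function.mem_support, ne_eq, mul_eq_zero, not_or] at hp
    refine ⟨abs_le.1 ?_, abs_le.1 ?_⟩
    · by_contra h; exact hp.2.1 ((hM _).2 (not_le.1 h))
    · by_contra h; exact hp.2.2 ((hN _).2 (not_le.1 h))

lemma trans_eq {g W : ℝ × ℝ → ℝ} (v : ℝ × ℝ) (hper : ∀ᵐ p : ℝ × ℝ ∂volume, g (p + v) = g p) :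
    ∫ p, g p * W (p - v) = ∫ p, g p * W p := by
  rw [← integral_add_right_eq_self (fun p => g p * W (p - v)) v]
  refine integral_congr_ae ?_
  filter_upwards [hper] with p hp
  simp [hp]

lemma trans_step1 {g : ℝ × ℝ → ℝ} (hg : LocallyIntegrable g volume) {a b c : ℝ → ℝ} {l : ℝ}
    (hper : ∀ᵐ p : ℝ × ℝ ∂volume, g (p.1 + l, p.2) = g p)
    (ha : Stp a) (hb : Stp b) (hc : BC1 c) :
    ∫ p, g p * ((a p.1 - a (p.1 - l)) * c p.2) = ∫ p, g p * ((b p.1 - b (p.1 - l)) * c p.2) := by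
  have h := trans_eq (g := g) (W := fun p => (a p.1 - b p.1) * c p.2) (l, 0) (by
    filter_upwards [hper] with p hp
    rw [← hp]; congr 1; ext <;> simp)
  simp only [Prod.fst_sub, Prod.snd_sub, sub_zero] at h
  have i1 := int_mul hg (ha.sub hb) hc
  have i2 := int_mul hg ((ha.shift l).sub (hb.shift l)) hc
  have i3 := int_mul hg (ha.sub (ha.shift l)) hc
  have i4 := int_mul hg (hb.sub (hb.shift l)) hc
  rw [← sub_eq_zero] at h ⊢
  rw [← integral_sub i2 i1] at h
  rw [← integral_sub i3 i4, ← neg_eq_zero, ← integral_neg, ← h]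
  congr 1; ext p; ring

lemma trans_step2 {g : ℝ × ℝ → ℝ} (hg : LocallyIntegrable g volume) {a b c : ℝ → ℝ} {l : ℝ}
    (hper : ∀ᵐ p : ℝ × ℝ ∂volume, g (p.1, p.2 + l) = g p)
    (ha : Stp a) (hb : Stp b) (hc : BC1 c) :
    ∫ p, g p * (c p.1 * (a p.2 - a (p.2 - l))) = ∫ p, g p * (c p.1 * (b p.2 - b (p.2 - l))) := by
  have h := trans_eq (g := g) (W := fun p => c p.1 * (a p.2 - b p.2)) (0, l) (by
    filter_upwards [hper] with p hp
    rw [← hp]; congr 1; ext <;> simp)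
  simp only [Prod.fst_sub, Prod.snd_sub, sub_zero] at h
  have i1 := int_mul hg hc (ha.sub hb)
  have i2 := int_mul hg hc ((ha.shift l).sub (hb.shift l))
  have i3 := int_mul hg hc (ha.sub (ha.shift l))
  have i4 := int_mul hg hc (hb.sub (hb.shift l))
  rw [← sub_eq_zero] at h ⊢
  rw [← integral_sub i2 i1] at h
  rw [← integral_sub i3 i4, ← neg_eq_zero, ← integral_neg, ← h]
  congr 1; ext p; ring

lemma exists_prim {w : ℝ → ℝ} (hw : ContDiff ℝ (⊤ : ℕ∞) w) (hc : HasCompactSupport w)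
    (h0 : ∫ x, w x = 0) :
    ∃ ψ : ℝ → ℝ, ContDiff ℝ (⊤ : ℕ∞) ψ ∧ HasCompactSupport ψ ∧ ∀ x, HasDerivAt ψ (w x) x := by
  obtain ⟨_, C, M, h⟩ := bc1_of_cont hw.continuous hc
  have hd : ∀ x, HasDerivAt (fun y => ∫ t in (-(|M| + 1))..y, w t) (w x) x := fun x =>
    intervalIntegral.integral_hasDerivAt_right (hw.continuous.intervalIntegrable _ _)
      (hw.continuous.stronglyMeasurableAtFilter _ _) hw.continuous.continuousAt
  refine ⟨_, ?_, ?_, hd⟩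
  · refine contDiff_infty_iff_deriv.2 ⟨fun x => (hd x).differentiableAt, ?_⟩
    rwa [show deriv (fun y => ∫ t in (-(|M| + 1))..y, w t) = w from funext fun x => (hd x).deriv]
  · refine HasCompactSupport.intro (isCompact_Icc (a := -(|M| + 1)) (b := |M| + 1)) fun x hx => ?_
    have hM := le_abs_self M
    have hM0 := abs_nonneg M
    by_cases h1 : x < -(|M| + 1)
    · rw [intervalIntegral.integral_symm, intervalIntegral.integral_zero_ae]
      · simp
      · refine Filter.Eventually.of_forall fun y hy => (h y).2 ?_
        rw [uIoc_of_le h1.le] at hy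
        exact lt_abs.2 (Or.inr (by linarith [hy.2]))
    · have h2 : |M| + 1 < x := by
        by_contra h3; exact hx ⟨not_lt.1 h1, not_lt.1 h3⟩
      rw [intervalIntegral.integral_of_le (by linarith), ← h0]
      refine setIntegral_eq_integral_of_forall_compl_eq_zero fun y hy => (h y).2 ?_
      by_contra h4
      have := abs_le.1 (not_lt.1 h4)
      exact hy ⟨by linarith, by linarith⟩

lemma line_avg {l₁ l₂ : ℝ} (hl₁ : 0 < l₁) (hl₂ : 0 < l₂) {f g : ℝ × ℝ → ℝ}
    (hf : LocallyIntegrable f volume) (hg : LocallyIntegrable g volume)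
    (hf1 : ∀ᵐ p : ℝ × ℝ ∂volume, f (p.1 + l₁, p.2) = f p)
    (hg1 : ∀ᵐ p : ℝ × ℝ ∂volume, g (p.1 + l₁, p.2) = g p)
    (hg2 : ∀ᵐ p : ℝ × ℝ ∂volume, g (p.1, p.2 + l₂) = g p)
    (hdiv : ∀ φ : ℝ × ℝ → ℝ, ContDiff ℝ (⊤ : ℕ∞) φ → HasCompactSupport φ →
      ∫ p : ℝ × ℝ, (f p * pd1 φ p + g p * pd2 φ p) = 0)
    (α β : ℝ)
    (hcont : ∃ U : Set (ℝ × ℝ), IsOpen U ∧ (∀ x : ℝ, (x, α) ∈ U) ∧ ContinuousOn g U) :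
    (∫ t in β..(β + l₁), g (t, α)) * l₂ = ∫ p in Ioo (0:ℝ) l₁ ×ˢ Ioo (0:ℝ) l₂, g p := by
  set R : ℝ → ℝ := (Ioc β (β + l₁)).indicator (fun _ => 1) with hR
  set R₂ : ℝ → ℝ := (Ioc 0 (0 + l₂)).indicator (fun _ => 1) with hR₂
  have hRe : ∀ x, R x = (if β < x then 1 else 0) - (if β < x - l₁ then 1 else 0) :=
    fun x => (ind_diff β l₁ x hl₁).symm
  have hR₂e : ∀ x, R₂ x = (if 0 < x then 1 else 0) - (if 0 < x - l₂ then 1 else 0) :=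
    fun x => (ind_diff 0 l₂ x hl₂).symm
  have bR : BC1 R := by
    rw [funext hRe]; exact (stp_ind β).sub ((stp_ind β).shift l₁)
  have bR₂ : BC1 R₂ := by
    rw [funext hR₂e]; exact (stp_ind 0).sub ((stp_ind 0).shift l₂)
  set χ : ℝ → ℝ := fun x => sst x - sst (x - l₁) with hχ
  set χ₂ : ℝ → ℝ := fun x => sst x - sst (x - l₂) with hχ₂
  have bχ : BC1 χ := stp_sst.sub (stp_sst.shift l₁)
  have bχ₂ : BC1 χ₂ := stp_sst.sub (stp_sst.shift l₂)
  have sχ : ContDiff ℝ (⊤ : ℕ∞) χ :=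
    sst_smooth.sub (sst_smooth.comp (contDiff_id.sub contDiff_const))
  have sχ₂ : ContDiff ℝ (⊤ : ℕ∞) χ₂ :=
    sst_smooth.sub (sst_smooth.comp (contDiff_id.sub contDiff_const))
  have iR : ∫ x, R x = l₁ := by
    rw [hR, integral_indicator measurableSet_Ioc]
    simp [hl₁.le]
  have iR₂ : ∫ x, R₂ x = l₂ := by
    rw [hR₂, integral_indicator measurableSet_Ioc]
    simp [hl₂.le]
  have iχ₂ : ∫ x, χ₂ x = l₂ := by
    have h := trans_step2 (g := fun _ => (1 : ℝ)) (l := l₂) (locallyIntegrable_const 1) (by simp)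
      stp_sst (stp_ind 0) bR
    simp only [one_mul, ← hR₂e] at h
    rw [Measure.volume_eq_prod, integral_prod_mul R χ₂, integral_prod_mul R R₂, iR, iR₂] at h
    exact mul_left_cancel₀ hl₁.ne' h
  -- integral over the cell
  have cell : ∫ p, g p * (R p.1 * R₂ p.2) = ∫ p in Ioo (0:ℝ) l₁ ×ˢ Ioo (0:ℝ) l₂, g p := by
    have h := trans_step1 hg hg1 (stp_ind β) (stp_ind 0) bR₂
    simp only [← hRe] at h
    rw [h]
    have e : (Ioo (0:ℝ) l₁ ×ˢ Ioo (0:ℝ) l₂ : Set (ℝ × ℝ)) =ᵐ[volume] Ioc (0:ℝ) l₁ ×ˢ Ioc (0:ℝ) l₂ := by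
      rw [Measure.volume_eq_prod]
      exact Measure.set_prod_ae_eq Ioo_ae_eq_Ioc Ioo_ae_eq_Ioc
    rw [setIntegral_congr_set e, ← integral_indicator (measurableSet_Ioc.prod measurableSet_Ioc)]
    congr 1; ext p
    rw [ind_diff 0 l₁ p.1 hl₁]
    simp only [hR₂, zero_add, indicator, mem_prod]
    split_ifs <;> simp_all
  -- key identity
  have key : ∀ η : ℝ → ℝ, ContDiff ℝ (⊤ : ℕ∞) η → HasCompactSupport η → ∫ x, η x = 1 →
      (∫ p, g p * (R p.1 * η p.2)) * l₂ = ∫ p in Ioo (0:ℝ) l₁ ×ˢ Ioo (0:ℝ) l₂, g p := by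
    intro η sη cη iη
    have bη := bc1_of_cont sη.continuous cη
    have intη : Integrable η := sη.continuous.integrable_of_hasCompactSupport cη
    have intχ₂ : Integrable χ₂ := sχ₂.continuous.integrable_of_hasCompactSupport bχ₂.compact
    obtain ⟨ψ, sψ, cψ, dψ⟩ := exists_prim (w := fun x => η x * l₂ - χ₂ x)
      ((sη.mul contDiff_const).sub sχ₂) ((cη.mul_right).sub bχ₂.compact) (by
        rw [integral_sub (intη.mul_const _) intχ₂, integral_mul_const, iη, iχ₂]; ring)
    have bψ := bc1_of_cont sψ.continuous cψ
    have dχ : ∀ x, HasDerivAt χ (deriv sst x - deriv sst (x - l₁)) x := by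
      intro x
      have hd := sst_smooth.differentiable (by simp)
      exact (hd x).hasDerivAt.sub ((hd (x - l₁)).hasDerivAt.comp_sub_const x l₁)
    have sds : Continuous (deriv sst) := sst_smooth.continuous_deriv (by simp)
    have bds : BC1 (deriv sst) := by
      refine bc1_of_cont sds ?_
      refine HasCompactSupport.intro (isCompact_Icc (a := 0) (b := 1)) fun x hx => ?_
      by_cases h : x < 0
      · have : sst =ᶠ[nhds x] fun _ => 0 := by
          filter_upwards [Iio_mem_nhds h] with y hy
          exact Real.smoothTransition.zero_of_nonpos (le_of_lt hy)
        rw [this.deriv_eq]; simp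
      · have h1 : 1 < x := by
          by_contra h3; exact hx ⟨not_lt.1 h, not_lt.1 h3⟩
        have : sst =ᶠ[nhds x] fun _ => 1 := by
          filter_upwards [Ioi_mem_nhds h1] with y hy
          exact Real.smoothTransition.one_of_one_le (le_of_lt hy)
        rw [this.deriv_eq]; simp
    have bds' : BC1 (fun x => deriv sst (x - l₁)) := by
      refine bc1_of_cont (sds.comp (continuous_id.sub continuous_const)) ?_
      exact bds.compact.comp_homeomorph (Homeomorph.subRight l₁)
    have hfd : ∀ p : ℝ × ℝ, HasFDerivAt (fun p : ℝ × ℝ => χ p.1 * ψ p.2)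
        (χ p.1 • ((η p.2 * l₂ - χ₂ p.2) • ContinuousLinearMap.snd ℝ ℝ ℝ) +
          ψ p.2 • ((deriv sst p.1 - deriv sst (p.1 - l₁)) • ContinuousLinearMap.fst ℝ ℝ ℝ)) p := by
      intro p
      exact ((dχ p.1).comp_hasFDerivAt p hasFDerivAt_fst).mul
        ((dψ p.2).comp_hasFDerivAt p hasFDerivAt_snd)
    have hd := hdiv (fun p => χ p.1 * ψ p.2)
      ((sχ.comp contDiff_fst).mul (sψ.comp contDiff_snd)) (by
        obtain ⟨_, C, M, hM⟩ := bχ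
        obtain ⟨_, D, N, hN⟩ := bψ
        refine HasCompactSupport.intro ((isCompact_Icc (a := -M) (b := M)).prod
          (isCompact_Icc (a := -N) (b := N))) fun p hp => ?_
        by_contra h
        simp only [mul_eq_zero, not_or] at h
        refine hp ⟨abs_le.1 ?_, abs_le.1 ?_⟩
        · by_contra h'; exact h.1 ((hM _).2 (not_le.1 h'))
        · by_contra h'; exact h.2 ((hN _).2 (not_le.1 h')))
    simp only [pd1, pd2, (hfd _).fderiv] at hd
    simp at hd
    have J1 := int_mul hf bds bψ
    have J2 := int_mul hf bds' bψ
    have J3 := int_mul hg bχ bη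
    have J4 := int_mul hg bχ bχ₂
    have h1 : ∫ p, f p * (deriv sst (p.1 - l₁) * ψ p.2) = ∫ p, f p * (deriv sst p.1 * ψ p.2) := by
      have := trans_eq (g := f) (W := fun p => deriv sst p.1 * ψ p.2) (l₁, 0) (by
        filter_upwards [hf1] with p hp
        rw [← hp]; congr 1; ext <;> simp)
      simpa using this
    have h2 : (∫ p, g p * (χ p.1 * η p.2)) * l₂ = ∫ p, g p * (χ p.1 * χ₂ p.2) := by
      have e : ∀ p : ℝ × ℝ, f p * (ψ p.2 * (deriv sst p.1 - deriv sst (p.1 - l₁))) +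
          g p * (χ p.1 * (η p.2 * l₂ - χ₂ p.2)) =
          (f p * (deriv sst p.1 * ψ p.2) - f p * (deriv sst (p.1 - l₁) * ψ p.2)) +
          (g p * (χ p.1 * η p.2) * l₂ - g p * (χ p.1 * χ₂ p.2)) := fun p => by ring
      simp only [e] at hd
      have K1 := integral_add (J1.sub J2) ((J3.mul_const l₂).sub J4)
      simp only [Pi.sub_apply] at K1
      rw [K1, integral_sub J1 J2, integral_sub (J3.mul_const l₂) J4, integral_mul_const, h1] at hd
      linarith
    have h3 := trans_step1 hg hg1 stp_sst (stp_ind β) bη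
    have h4 := trans_step1 hg hg1 stp_sst (stp_ind β) bχ₂
    have h5 := trans_step2 hg hg2 stp_sst (stp_ind 0) bR
    simp only [← hRe, ← hR₂e] at h3 h4 h5
    rw [← h3, h2, h4, h5, cell]
  -- approximation
  obtain ⟨U, hU, hUα, hgU⟩ := hcont
  have gline : Continuous fun t => g (t, α) := by
    rw [continuous_iff_continuousAt]
    intro t
    exact ContinuousAt.comp (f := fun t : ℝ => (t, α)) (hgU.continuousAt (hU.mem_nhds (hUα t)))
      (by fun_prop)
  rw [← sub_eq_zero, ← abs_eq_zero]
  refine le_antisymm (le_of_forall_pos_le_add fun ε hε => ?_) (abs_nonneg _)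
  rw [zero_add]
  obtain ⟨ε', hε', hεε⟩ : ∃ ε' > 0, ε' * l₁ * l₂ = ε := ⟨ε / (l₁ * l₂), by positivity, by field_simp⟩
  have tube : ∀ᶠ y in nhds α, ∀ x ∈ Icc β (β + l₁), |g (x, y) - g (x, α)| < ε' := by
    refine isCompact_Icc.eventually_forall_of_forall_eventually fun x _ => ?_
    have c1 : ContinuousAt (fun z : ℝ × ℝ => g (z.2, z.1) - g (z.2, α)) (α, x) := by
      refine ContinuousAt.sub ?_ ?_
      · exact ContinuousAt.comp (f := fun z : ℝ × ℝ => (z.2, z.1)) (x := (α, x)) 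
          (hgU.continuousAt (hU.mem_nhds (hUα x))) (by fun_prop)
      · exact (gline.comp continuous_snd).continuousAt
    have c2 := c1.abs
    exact c2.eventually_lt continuousAt_const (by simpa using hε')
  obtain ⟨δ, hδ, hball⟩ := Metric.eventually_nhds_iff_ball.1 tube
  let φ : ContDiffBump α := ⟨δ / 2, δ, by linarith, by linarith⟩
  have sη : ContDiff ℝ (⊤ : ℕ∞) (φ.normed volume) := φ.contDiff_normed
  have cη : HasCompactSupport (φ.normed volume) := φ.hasCompactSupport_normed
  have iη : ∫ x, φ.normed volume x = 1 := φ.integral_normed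
  have bη := bc1_of_cont sη.continuous cη
  rw [← key _ sη cη iη, ← sub_mul, abs_mul, abs_of_pos hl₂, ← hεε]
  refine mul_le_mul_of_nonneg_right ?_ hl₂.le
  have hline : ∫ t in β..(β + l₁), g (t, α) = ∫ p : ℝ × ℝ, g (p.1, α) * (R p.1 * φ.normed volume p.2) := by
    have : ∀ p : ℝ × ℝ, g (p.1, α) * (R p.1 * φ.normed volume p.2) =
      (g (p.1, α) * R p.1) * φ.normed volume p.2 := fun p => by ring
    simp only [this]
    rw [Measure.volume_eq_prod, integral_prod_mul (fun x => g (x, α) * R x) (φ.normed volume), iη, mul_one,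
      intervalIntegral.integral_of_le (by linarith), ← integral_indicator measurableSet_Ioc]
    congr 1; ext x
    simp [hR, indicator]
  have lg : LocallyIntegrable (fun p : ℝ × ℝ => g (p.1, α)) volume :=
    (gline.comp continuous_fst).locallyIntegrable
  have I1 := int_mul lg bR bη
  have I2 := int_mul hg bR bη
  have I3 : Integrable (fun p : ℝ × ℝ => ε' * (R p.1 * φ.normed volume p.2)) := by
    simpa using int_mul (locallyIntegrable_const (1:ℝ)) bR bη |>.const_mul ε'
  rw [hline, ← integral_sub I1 I2, ← Real.norm_eq_abs]
  have hfin : ∫ p : ℝ × ℝ, ε' * (R p.1 * φ.normed volume p.2) = ε' * l₁ := by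
    rw [integral_const_mul, Measure.volume_eq_prod, integral_prod_mul R (φ.normed volume), iR, iη, mul_one]
  rw [← hfin]
  refine norm_integral_le_of_norm_le I3 (Filter.Eventually.of_forall fun p => ?_)
  rw [← sub_mul, norm_mul]
  have hη0 := φ.nonneg_normed (μ := volume) p.2
  have hR0 : 0 ≤ R p.1 := indicator_nonneg (fun _ _ => zero_le_one) _
  rw [Real.norm_eq_abs, Real.norm_eq_abs, abs_of_nonneg (mul_nonneg hR0 hη0)]
  by_cases hx : p.1 ∈ Ioc β (β + l₁)
  · by_cases hy : p.2 ∈ Metric.ball α δ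
    · refine mul_le_mul_of_nonneg_right ?_ (mul_nonneg hR0 hη0)
      rw [abs_sub_comm]
      exact (hball _ hy _ (Ioc_subset_Icc_self hx)).le
    · have : φ.normed volume p.2 = 0 := by
        rw [← Function.notMem_support, φ.support_normed_eq]; exact hy
      simp [this]
  · have : R p.1 = 0 := indicator_of_notMem hx _
    simp [this]

lemma cd_pd1 {n m : ℕ} {f : ℝ × ℝ → ℝ} {V : Set (ℝ × ℝ)} (hV : IsOpen V) (hf : ContDiffOn ℝ n f V)
    (hmn : m + 1 ≤ n) : ContDiffOn ℝ m (pd1 f) V :=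
  (hf.fderiv_of_isOpen hV (by exact_mod_cast hmn)).clm_apply contDiffOn_const

lemma cd_pd2 {n m : ℕ} {f : ℝ × ℝ → ℝ} {V : Set (ℝ × ℝ)} (hV : IsOpen V) (hf : ContDiffOn ℝ n f V)
    (hmn : m + 1 ≤ n) : ContDiffOn ℝ m (pd2 f) V :=
  (hf.fderiv_of_isOpen hV (by exact_mod_cast hmn)).clm_apply contDiffOn_const

lemma pd_symm {f : ℝ × ℝ → ℝ} {V : Set (ℝ × ℝ)} (hV : IsOpen V) (hf : ContDiffOn ℝ (2 : ℕ) f V)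
    {p : ℝ × ℝ} (hp : p ∈ V) : pd1 (pd2 f) p = pd2 (pd1 f) p := by
  have hs := (hf.contDiffAt (hV.mem_nhds hp)).isSymmSndFDerivAt (by simp)
  have h1 : DifferentiableAt ℝ (fderiv ℝ f) p :=
    ((hf.fderiv_of_isOpen hV (m := 1) (by norm_num)).contDiffAt
      (hV.mem_nhds hp)).differentiableAt (by simp)
  have key : ∀ v w : ℝ × ℝ, fderiv ℝ (fun q => fderiv ℝ f q v) p w = fderiv ℝ (fderiv ℝ f) p w v := by
    intro v w
    rw [fderiv_clm_apply h1 (differentiableAt_const v)]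
    simp
  have e1 : pd2 f = fun q => fderiv ℝ f q (0, 1) := rfl
  have e2 : pd1 f = fun q => fderiv ℝ f q (1, 0) := rfl
  rw [pd1, pd2, e1, e2, key, key]
  exact hs.eq _ _

lemma pd1_lin {s f g : ℝ × ℝ → ℝ} {V : Set (ℝ × ℝ)} (hV : IsOpen V) {a b : ℝ}
    (hf : ContDiffOn ℝ (1 : ℕ) f V) (hg : ContDiffOn ℝ (1 : ℕ) g V)
    (hs : ∀ p ∈ V, s p = a * f p + b * g p) {p : ℝ × ℝ} (hp : p ∈ V) :
    pd1 s p = a * pd1 f p + b * pd1 g p := by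
  have df := ((hf.contDiffAt (hV.mem_nhds hp)).differentiableAt (by simp)).hasFDerivAt
  have dg := ((hg.contDiffAt (hV.mem_nhds hp)).differentiableAt (by simp)).hasFDerivAt
  have e : s =ᶠ[nhds p] fun p => a * f p + b * g p := by
    filter_upwards [hV.mem_nhds hp] with q hq using hs q hq
  unfold pd1
  rw [e.fderiv_eq, HasFDerivAt.fderiv (f := fun p => a * f p + b * g p)
    ((df.const_mul a).add (dg.const_mul b))]
  simp

lemma pd2_lin {s f g : ℝ × ℝ → ℝ} {V : Set (ℝ × ℝ)} (hV : IsOpen V) {a b : ℝ}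
    (hf : ContDiffOn ℝ (1 : ℕ) f V) (hg : ContDiffOn ℝ (1 : ℕ) g V)
    (hs : ∀ p ∈ V, s p = a * f p + b * g p) {p : ℝ × ℝ} (hp : p ∈ V) :
    pd2 s p = a * pd2 f p + b * pd2 g p := by
  have df := ((hf.contDiffAt (hV.mem_nhds hp)).differentiableAt (by simp)).hasFDerivAt
  have dg := ((hg.contDiffAt (hV.mem_nhds hp)).differentiableAt (by simp)).hasFDerivAt
  have e : s =ᶠ[nhds p] fun p => a * f p + b * g p := by
    filter_upwards [hV.mem_nhds hp] with q hq using hs q hq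
  unfold pd2
  rw [e.fderiv_eq, HasFDerivAt.fderiv (f := fun p => a * f p + b * g p)
    ((df.const_mul a).add (dg.const_mul b))]
  simp

lemma cd_lin {s f g : ℝ × ℝ → ℝ} {V : Set (ℝ × ℝ)} {a b : ℝ}
    (hf : ContDiffOn ℝ (1 : ℕ) f V) (hg : ContDiffOn ℝ (1 : ℕ) g V)
    (hs : ∀ p ∈ V, s p = a * f p + b * g p) : ContDiffOn ℝ (1 : ℕ) s V :=
  ((contDiffOn_const.mul hf).add (contDiffOn_const.mul hg)).congr hs

lemma hd1 {f : ℝ × ℝ → ℝ} {V : Set (ℝ × ℝ)} (hV : IsOpen V) (hf : ContDiffOn ℝ (1 : ℕ) f V)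
    {x y : ℝ} (hp : (x, y) ∈ V) : HasDerivAt (fun t => f (t, y)) (pd1 f (x, y)) x := by
  have df := ((hf.contDiffAt (hV.mem_nhds hp)).differentiableAt (by simp)).hasFDerivAt
  exact HasFDerivAt.comp_hasDerivAt (f := fun t : ℝ => (t, y)) x df
    ((hasDerivAt_id x).prodMk (hasDerivAt_const x y))

lemma hd2 {f : ℝ × ℝ → ℝ} {V : Set (ℝ × ℝ)} (hV : IsOpen V) (hf : ContDiffOn ℝ (1 : ℕ) f V)
    {x y : ℝ} (hp : (x, y) ∈ V) : HasDerivAt (fun t => f (x, t)) (pd2 f (x, y)) y := by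
  have df := ((hf.contDiffAt (hV.mem_nhds hp)).differentiableAt (by simp)).hasFDerivAt
  exact HasFDerivAt.comp_hasDerivAt (f := fun t : ℝ => (x, t)) y df
    ((hasDerivAt_const y x).prodMk (hasDerivAt_id y))

/-- Representation of the quasiperiod `ξ₁₂` in terms of the cell average of `σ₁₂` and weighted
line integrals of the derivatives of the trace of the stress over the segments `γ₁'` and
`γ₂'`. -/
theorem quasiperiod_xi12_representation
    (l₁ l₂ : ℝ) (hl₁ : 0 < l₁) (hl₂ : 0 < l₂)
    (σ11 σ12 σ22 : ℝ × ℝ → ℝ)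
    (hloc11 : LocallyIntegrable σ11 volume)
    (hloc12 : LocallyIntegrable σ12 volume)
    (hloc22 : LocallyIntegrable σ22 volume)
    (hper : ∀ᵐ p : ℝ × ℝ ∂volume,
      σ11 (p.1 + l₁, p.2) = σ11 p ∧ σ11 (p.1, p.2 + l₂) = σ11 p ∧
      σ12 (p.1 + l₁, p.2) = σ12 p ∧ σ12 (p.1, p.2 + l₂) = σ12 p ∧
      σ22 (p.1 + l₁, p.2) = σ22 p ∧ σ22 (p.1, p.2 + l₂) = σ22 p)
    (hdiv : ∀ φ₁ φ₂ : ℝ × ℝ → ℝ, ContDiff ℝ (⊤ : ℕ∞) φ₁ → ContDiff ℝ (⊤ : ℕ∞) φ₂ →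
      HasCompactSupport φ₁ → HasCompactSupport φ₂ →
      ∫ p : ℝ × ℝ, (σ11 p * pd1 φ₁ p + σ12 p * pd2 φ₁ p
        + σ12 p * pd1 φ₂ p + σ22 p * pd2 φ₂ p) = 0)
    (α β : ℝ)
    (hcontH : ∃ U : Set (ℝ × ℝ), IsOpen U ∧ (∀ x : ℝ, (x, α) ∈ U) ∧
      ContinuousOn σ11 U ∧ ContinuousOn σ12 U ∧ ContinuousOn σ22 U)
    (hcontV : ∃ U : Set (ℝ × ℝ), IsOpen U ∧ (∀ y : ℝ, (β, y) ∈ U) ∧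
      ContinuousOn σ11 U ∧ ContinuousOn σ12 U ∧ ContinuousOn σ22 U)
    (K G : ℝ) (hK : 0 < K) (hG : 0 < G)
    (V : Set (ℝ × ℝ)) (hV : IsOpen V)
    (hγV : Icc β (β + l₁) ×ˢ ({α} : Set ℝ) ∪ ({β} : Set ℝ) ×ˢ Icc α (α + l₂) ⊆ V)
    (u : ℝ × ℝ → ℝ × ℝ) (hu : ContDiffOn ℝ 2 u V)
    (hHooke : ∀ p ∈ V,
      σ11 p = (K + G) * eps11 u p + (K - G) * eps22 u p ∧
      σ22 p = (K - G) * eps11 u p + (K + G) * eps22 u p ∧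
      σ12 p = 2 * G * eps12 u p)
    (hequil : ∀ p ∈ V,
      pd1 σ11 p + pd2 σ12 p = 0 ∧ pd1 σ12 p + pd2 σ22 p = 0)
    (ξ12 : ℝ)
    (hξ₁ : (u (β + l₁, α)).2 - (u (β, α)).2 = ξ12 * l₁)
    (hξ₂ : (u (β, α + l₂)).1 - (u (β, α)).1 = ξ12 * l₂)
    (hω₁ : omega21 u (β + l₁, α) = omega21 u (β, α))
    (hω₂ : omega21 u (β, α + l₂) = omega21 u (β, α)) :
    ξ12 = (1 / (2 * G)) * ((1 / (l₁ * l₂)) * ∫ p in Ioo (0:ℝ) l₁ ×ˢ Ioo (0:ℝ) l₂, σ12 p)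
      + (1 / 8) * (1 / K + 1 / G) *
        ((1 / l₁) * (∫ t in β..(β + l₁), pd2 (fun q => σ11 q + σ22 q) (t, α) * t)
          + (1 / l₂) * (∫ t in α..(α + l₂), pd1 (fun q => σ11 q + σ22 q) (β, t) * t)) := by
  -- line averages
  have hL1 : (∫ t in β..(β + l₁), σ12 (t, α)) * l₂ =
      ∫ p in Ioo (0:ℝ) l₁ ×ˢ Ioo (0:ℝ) l₂, σ12 p := by
    refine line_avg hl₁ hl₂ hloc11 hloc12 (hper.mono fun p h => h.1)
      (hper.mono fun p h => h.2.2.1) (hper.mono fun p h => h.2.2.2.1) ?_ α β ?_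
    · intro φ hφ hc
      have := hdiv φ (fun _ => 0) hφ contDiff_const hc HasCompactSupport.zero
      simpa [pd1, pd2] using this
    · obtain ⟨U, h1, h2, _, h3, _⟩ := hcontH
      exact ⟨U, h1, h2, h3⟩
  have mps : MeasurePreserving (Prod.swap : ℝ × ℝ → ℝ × ℝ) volume volume := by
    rw [Measure.volume_eq_prod]; exact Measure.measurePreserving_swap
  have emb : MeasurableEmbedding (Prod.swap : ℝ × ℝ → ℝ × ℝ) :=
    MeasurableEquiv.prodComm.measurableEmbedding
  have lswap : ∀ f : ℝ × ℝ → ℝ, LocallyIntegrable f volume →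
      LocallyIntegrable (fun p : ℝ × ℝ => f p.swap) volume := by
    intro f hf
    rw [locallyIntegrable_iff] at hf ⊢
    intro k hk
    have hk' : IsCompact (Prod.swap '' k) := hk.image continuous_swap
    have := (mps.integrableOn_comp_preimage emb (f := f) (s := Prod.swap '' k)).2 (hf _ hk')
    rwa [preimage_image_eq _ Prod.swap_injective] at this
  have hper' := mps.quasiMeasurePreserving.ae hper
  have hL2 : (∫ t in α..(α + l₂), σ12 (β, t)) * l₁ =
      ∫ p in Ioo (0:ℝ) l₁ ×ˢ Ioo (0:ℝ) l₂, σ12 p := by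
    have h := line_avg (f := fun p : ℝ × ℝ => σ22 p.swap) (g := fun p : ℝ × ℝ => σ12 p.swap) hl₂ hl₁
      (lswap _ hloc22) (lswap _ hloc12) (hper'.mono fun p h => h.2.2.2.2.2)
      (hper'.mono fun p h => h.2.2.2.1) (hper'.mono fun p h => h.2.2.1) ?_ β α ?_
    · refine h.trans ?_
      rw [← mps.setIntegral_preimage_emb emb]
      simp [preimage_swap_prod]
    · intro φ hφ hc
      have := hdiv (fun _ => 0) (fun p => φ p.swap) contDiff_const
        (hφ.comp (contDiff_snd.prodMk contDiff_fst)) HasCompactSupport.zero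
        (hc.comp_homeomorph (Homeomorph.prodComm ℝ ℝ))
      have hd : ∀ p : ℝ × ℝ, fderiv ℝ (fun p : ℝ × ℝ => φ p.swap) p =
          (fderiv ℝ φ p.swap).comp ((ContinuousLinearMap.snd ℝ ℝ ℝ).prod
            (ContinuousLinearMap.fst ℝ ℝ ℝ)) := by
        intro p
        have h1 := (hφ.differentiable (by simp) p.swap).hasFDerivAt
        exact (h1.comp p (hasFDerivAt_snd.prodMk hasFDerivAt_fst)).fderiv
      rw [← mps.integral_comp emb]
      rw [← this]
      congr 1; ext p
      simp [pd1, pd2, hd]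
      ring
    · obtain ⟨U, h1, h2, _, h3, _⟩ := hcontV
      exact ⟨Prod.swap ⁻¹' U, h1.preimage continuous_swap, fun x => h2 x,
        h3.comp continuous_swap.continuousOn fun p hp => hp⟩
  -- calculus
  have cu1 : ContDiffOn ℝ (2 : ℕ) (fun q => (u q).1) V := contDiff_fst.comp_contDiffOn hu
  have cu2 : ContDiffOn ℝ (2 : ℕ) (fun q => (u q).2) V := contDiff_snd.comp_contDiffOn hu
  have ca1 : ContDiffOn ℝ (1 : ℕ) (pd1 fun q => (u q).1) V := cd_pd1 hV cu1 le_rfl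
  have cb1 : ContDiffOn ℝ (1 : ℕ) (pd2 fun q => (u q).1) V := cd_pd2 hV cu1 le_rfl
  have ca2 : ContDiffOn ℝ (1 : ℕ) (pd1 fun q => (u q).2) V := cd_pd1 hV cu2 le_rfl
  have cb2 : ContDiffOn ℝ (1 : ℕ) (pd2 fun q => (u q).2) V := cd_pd2 hV cu2 le_rfl
  have e11 : ∀ p ∈ V, σ11 p = (K + G) * pd1 (fun q => (u q).1) p
      + (K - G) * pd2 (fun q => (u q).2) p := fun p hp => (hHooke p hp).1
  have e22 : ∀ p ∈ V, σ22 p = (K - G) * pd1 (fun q => (u q).1) p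
      + (K + G) * pd2 (fun q => (u q).2) p := fun p hp => (hHooke p hp).2.1
  have e12 : ∀ p ∈ V, σ12 p = G * pd2 (fun q => (u q).1) p + G * pd1 (fun q => (u q).2) p := by
    intro p hp
    rw [(hHooke p hp).2.2, eps12]; ring
  have etr : ∀ p ∈ V, (fun q => σ11 q + σ22 q) p = (2 * K) * pd1 (fun q => (u q).1) p
      + (2 * K) * pd2 (fun q => (u q).2) p := by
    intro p hp
    show σ11 p + σ22 p = _
    rw [e11 p hp, e22 p hp]; ring
  have eom : ∀ p ∈ V, omega21 u p = (1 / 2) * pd1 (fun q => (u q).2) p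
      + (-(1 / 2)) * pd2 (fun q => (u q).1) p := by
    intro p hp
    rw [omega21]; ring
  have c12 := cd_lin cb1 ca2 e12
  have ctr := cd_lin ca1 cb2 etr
  have com := cd_lin ca2 cb1 eom
  have ktr1 : ContinuousOn (pd1 fun q => σ11 q + σ22 q) V :=
    (cd_pd1 (m := 0) hV ctr le_rfl).continuousOn
  have ktr2 : ContinuousOn (pd2 fun q => σ11 q + σ22 q) V :=
    (cd_pd2 (m := 0) hV ctr le_rfl).continuousOn
  have dom1 : ∀ p ∈ V, pd1 (omega21 u) p =
      -(1 / 4) * (1 / K + 1 / G) * pd2 (fun q => σ11 q + σ22 q) p := by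
    intro p hp
    have h := (hequil p hp).2
    rw [pd1_lin hV cb1 ca2 e12 hp, pd2_lin hV ca1 cb2 e22 hp, pd_symm hV cu1 hp] at h
    rw [pd1_lin hV ca2 cb1 eom hp, pd2_lin hV ca1 cb2 etr hp, pd_symm hV cu1 hp]
    field_simp
    linear_combination 4 * h
  have dom2 : ∀ p ∈ V, pd2 (omega21 u) p =
      (1 / 4) * (1 / K + 1 / G) * pd1 (fun q => σ11 q + σ22 q) p := by
    intro p hp
    have h := (hequil p hp).1
    rw [pd2_lin hV cb1 ca2 e12 hp, pd1_lin hV ca1 cb2 e11 hp, pd_symm hV cu2 hp] at h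
    rw [pd2_lin hV ca2 cb1 eom hp, pd1_lin hV ca1 cb2 etr hp, pd_symm hV cu2 hp]
    field_simp
    linear_combination (-4) * h
  have hH : ∀ t ∈ uIcc β (β + l₁), (t, α) ∈ V := fun t ht => by
    rw [uIcc_of_le (by linarith)] at ht
    exact hγV (Or.inl ⟨ht, rfl⟩)
  have hVv : ∀ t ∈ uIcc α (α + l₂), (β, t) ∈ V := fun t ht => by
    rw [uIcc_of_le (by linarith)] at ht
    exact hγV (Or.inr ⟨rfl, ht⟩)
  have i12H : IntervalIntegrable (fun t => σ12 (t, α)) volume β (β + l₁) :=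
    (c12.continuousOn.comp (by fun_prop) hH).intervalIntegrable
  have i12V : IntervalIntegrable (fun t => σ12 (β, t)) volume α (α + l₂) :=
    (c12.continuousOn.comp (by fun_prop) hVv).intervalIntegrable
  have itH : IntervalIntegrable (fun t => pd2 (fun q => σ11 q + σ22 q) (t, α) * t) volume β (β + l₁) :=
    ((ktr2.comp (f := fun t : ℝ => (t, α)) (by fun_prop) hH).mul continuousOn_id).intervalIntegrable
  have itV : IntervalIntegrable (fun t => pd1 (fun q => σ11 q + σ22 q) (β, t) * t) volume α (α + l₂) :=
    ((ktr1.comp (f := fun t : ℝ => (β, t)) (by fun_prop) hVv).mul continuousOn_id).intervalIntegrable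
  have F1 := intervalIntegral.integral_eq_sub_of_hasDerivAt
    (f := fun t => (u (t, α)).2 - t * omega21 u (t, α))
    (f' := fun t => (1 / (2 * G)) * σ12 (t, α) +
      (1 / 4) * (1 / K + 1 / G) * (pd2 (fun q => σ11 q + σ22 q) (t, α) * t))
    (a := β) (b := β + l₁) (by
      intro t ht
      have hp := hH t ht
      have h := (hd1 hV (cu2.of_le (by norm_num)) hp).sub
        ((hasDerivAt_id t).mul (hd1 hV com hp))
      refine h.congr_deriv ?_
      rw [dom1 _ hp, eom _ hp, e12 _ hp]
      simp only [id]
      field_simp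
      ring) ((i12H.const_mul _).add (itH.const_mul _))
  have F2 := intervalIntegral.integral_eq_sub_of_hasDerivAt
    (f := fun t => (u (β, t)).1 + t * omega21 u (β, t))
    (f' := fun t => (1 / (2 * G)) * σ12 (β, t) +
      (1 / 4) * (1 / K + 1 / G) * (pd1 (fun q => σ11 q + σ22 q) (β, t) * t))
    (a := α) (b := α + l₂) (by
      intro t ht
      have hp := hVv t ht
      have h := (hd2 hV (cu1.of_le (by norm_num)) hp).add
        ((hasDerivAt_id t).mul (hd2 hV com hp))
      refine h.congr_deriv ?_
      rw [dom2 _ hp, eom _ hp, e12 _ hp]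
      simp only [id]
      field_simp
      ring) ((i12V.const_mul _).add (itV.const_mul _))
  rw [intervalIntegral.integral_add (i12H.const_mul _) (itH.const_mul _),
    intervalIntegral.integral_const_mul, intervalIntegral.integral_const_mul, hω₁] at F1
  rw [intervalIntegral.integral_add (i12V.const_mul _) (itV.const_mul _),
    intervalIntegral.integral_const_mul, intervalIntegral.integral_const_mul, hω₂] at F2
  generalize (∫ t in β..(β + l₁), pd2 (fun q => σ11 q + σ22 q) (t, α) * t) = T1 at *
  generalize (∫ t in α..(α + l₂), pd1 (fun q => σ11 q + σ22 q) (β, t) * t) = T2 at *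
  generalize (∫ p in Ioo (0:ℝ) l₁ ×ˢ Ioo (0:ℝ) l₂, σ12 p) = Y at *
  generalize (∫ t in β..(β + l₁), σ12 (t, α)) = L1 at *
  generalize (∫ t in α..(α + l₂), σ12 (β, t)) = L2 at *
  generalize omega21 u (β, α) = w at *
  have F1' : (1 / (2 * G)) * L1 + (1 / 4) * (1 / K + 1 / G) * T1 = ξ12 * l₁ - l₁ * w := by
    linear_combination F1 + hξ₁
  have F2' : (1 / (2 * G)) * L2 + (1 / 4) * (1 / K + 1 / G) * T2 = ξ12 * l₂ + l₂ * w := by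
    linear_combination F2 + hξ₂
  have q1 : L1 = Y / l₂ := by rw [← hL1]; field_simp
  have q2 : L2 = Y / l₁ := by rw [← hL2]; field_simp
  rw [q1] at F1'
  rw [q2] at F2'
  have G1 : ξ12 = (1 / (2 * G)) * (Y / l₂) / l₁ + (1 / 4) * (1 / K + 1 / G) * T1 / l₁ + w := by
    rw [← add_div, F1']; field_simp; ring
  have G2 : ξ12 = (1 / (2 * G)) * (Y / l₁) / l₂ + (1 / 4) * (1 / K + 1 / G) * T2 / l₂ - w := by
    rw [← add_div, F2']; field_simp; ring
  have G3 : ξ12 = (ξ12 + ξ12) / 2 := by ring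
  rw [G3]
  nth_rewrite 1 [G1]
  rw [G2]
  field_simp
  ring
end
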